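/- Consider the zero-sum game with horizontal trajectories in the Heisenberg group under assumptions 1., 2., 3.. Let ψ ∈ Γ¹((0,T)×ℝ³), let (t₀,x₀) ∈ (0,T)×ℝ³, and suppose there exists θ > 0 such that ∂ψ/∂t(t₀,x₀) + H⁻(t₀, x₀, ∇_H ψ(t₀,x₀)) ≤ −θ. Then for all sufficiently small τ > 0 there exists a nonanticipative strategy β̃ ∈ 𝒮_β(t₀) such that for every ỹ ∈ 𝒴(t₀) one has ∫_{t₀}^{t₀+τ} ( ∂ψ/∂t(s, x̃(s)) + F(s, x̃(s), ỹ(s), β̃[ỹ](s)) − β̃[ỹ](s)·∇_H ψ(s, x̃(s)) ) ds ≤ −τθ/2, where x̃ is the horizontal curve on [t₀, t₀+τ] with horizontal velocity β̃[ỹ] and initial point x₀. -/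

import Mathlib

open MeasureTheory Set

noncomputable section

/-- Heisenberg group law on ℝ³. -/
def hMul (a b : ℝ × ℝ × ℝ) : ℝ × ℝ × ℝ :=
  (a.1 + b.1, a.2.1 + b.2.1, a.2.2 + b.2.2 + (a.1 * b.2.1 - b.1 * a.2.1) / 2)

/-- Korányi gauge. -/
def gaugeH (a : ℝ × ℝ × ℝ) : ℝ :=
  ((a.1 ^ 2 + a.2.1 ^ 2) ^ 2 + a.2.2 ^ 2) ^ ((1 : ℝ) / 4)

/-- Korányi distance `d_G(x,x') = ‖(x')⁻¹ ∘ x‖_G` (the inverse is `-x'`). -/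
def dG (a b : ℝ × ℝ × ℝ) : ℝ := gaugeH (hMul (-b) a)

/-- Euclidean norm on ℝ². -/
def norm2 (v : ℝ × ℝ) : ℝ := Real.sqrt (v.1 ^ 2 + v.2 ^ 2)

/-- Euclidean dot product on ℝ². -/
def dot2 (v w : ℝ × ℝ) : ℝ := v.1 * w.1 + v.2 * w.2

/-- Euclidean norm on ℝ³. -/
def norm3 (v : ℝ × ℝ × ℝ) : ℝ := Real.sqrt (v.1 ^ 2 + v.2.1 ^ 2 + v.2.2 ^ 2)

/-- The horizontal dynamics `f^ℍ(x,z) = (z₁, z₂, (z₂x₁ - z₁x₂)/2)`. -/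
def fH (x : ℝ × ℝ × ℝ) (z : ℝ × ℝ) : ℝ × ℝ × ℝ :=
  (z.1, z.2, (z.2 * x.1 - z.1 * x.2.1) / 2)

/-- `x` is the horizontal curve on `[a,b]` with horizontal velocity `z` and
initial point `ξ`, i.e. `x(t) = ξ + ∫_a^t f^ℍ(x(s), z(s)) ds`. -/
def IsHorizontalCurveOn (a b : ℝ) (z : ℝ → ℝ × ℝ) (ξ : ℝ × ℝ × ℝ)
    (x : ℝ → ℝ × ℝ × ℝ) : Prop :=
  ∀ t ∈ Set.Icc a b, x t = ξ + ∫ s in a..t, fH (x s) (z s)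

/-- The set of controls at time `τ` with values in the closed ball of radius `R`:
measurable functions `[τ,T] → {v : ‖v‖ ≤ R}` (extended to all of ℝ). -/
abbrev Control (τ T R : ℝ) : Type :=
  {y : ℝ → ℝ × ℝ // Measurable y ∧ ∀ t ∈ Set.Icc τ T, norm2 (y t) ≤ R}

/-- Nonanticipative strategies for Player II at time `τ`: maps `β : 𝒴(τ) → 𝒵(τ)`
such that `y = y'` a.e. on `[τ,t]` implies `β[y] = β[y']` a.e. on `[τ,t]`. -/
structure Strategy (τ T RY RZ : ℝ) where
  toFun : Control τ T RY → Control τ T RZ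
  nonanticipative : ∀ t ∈ Set.Icc τ T, ∀ y y' : Control τ T RY,
    (∀ᵐ s ∂(volume.restrict (Set.Icc τ t)), y.1 s = y'.1 s) →
    (∀ᵐ s ∂(volume.restrict (Set.Icc τ t)), (toFun y).1 s = (toFun y').1 s)

/-- Nonanticipative strategies for Player I at time `τ`: maps `α : 𝒵(τ) → 𝒴(τ)`. -/
structure StrategyI (τ T RY RZ : ℝ) where
  toFun : Control τ T RZ → Control τ T RY
  nonanticipative : ∀ t ∈ Set.Icc τ T, ∀ z z' : Control τ T RZ,
    (∀ᵐ s ∂(volume.restrict (Set.Icc τ t)), z.1 s = z'.1 s) →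
    (∀ᵐ s ∂(volume.restrict (Set.Icc τ t)), (toFun z).1 s = (toFun z').1 s)

/-- The horizontal curve on `[a, ·]` with horizontal velocity `z` and initial point `ξ`,
given explicitly: `x₁, x₂` are integrals of `z₁, z₂`, and
`x₃(t) = ξ₃ + ∫ (z₂ x₁ - z₁ x₂)/2`.  It is the unique solution of
`x(t) = ξ + ∫_a^t f^ℍ(x(s), z(s)) ds`. -/
def horiz (a : ℝ) (ξ : ℝ × ℝ × ℝ) (z : ℝ → ℝ × ℝ) (t : ℝ) : ℝ × ℝ × ℝ :=
  (ξ.1 + ∫ s in a..t, (z s).1,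
   ξ.2.1 + ∫ s in a..t, (z s).2,
   ξ.2.2 + ∫ s in a..t,
     ((z s).2 * (ξ.1 + ∫ r in a..s, (z r).1) -
      (z s).1 * (ξ.2.1 + ∫ r in a..s, (z r).2)) / 2)

/-- The lower value function
`V⁻(τ,ξ) = inf_β sup_y { ∫_τ^T F(t, x(t), y(t), β[y](t)) dt + g(x(T)) }`,
where `x` is the horizontal curve on `[τ,T]` with horizontal velocity `-β[y]`
and initial point `ξ`. -/
def lowerValue (T RY RZ : ℝ) (F : ℝ → (ℝ × ℝ × ℝ) → (ℝ × ℝ) → (ℝ × ℝ) → ℝ)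
    (g : (ℝ × ℝ × ℝ) → ℝ) (τ : ℝ) (ξ : ℝ × ℝ × ℝ) : ℝ :=
  ⨅ β : Strategy τ T RY RZ, ⨆ y : Control τ T RY,
    ((∫ t in τ..T,
        F t (horiz τ ξ (fun s => -((β.toFun y).1 s)) t) (y.1 t) ((β.toFun y).1 t)) +
      g (horiz τ ξ (fun s => -((β.toFun y).1 s)) T))

/-- The upper value function
`V⁺(τ,ξ) = sup_α inf_z { ∫_τ^T F(t, x(t), α[z](t), z(t)) dt + g(x(T)) }`,
where `x` is the horizontal curve on `[τ,T]` with horizontal velocity `-z`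
and initial point `ξ`. -/
def upperValue (T RY RZ : ℝ) (F : ℝ → (ℝ × ℝ × ℝ) → (ℝ × ℝ) → (ℝ × ℝ) → ℝ)
    (g : (ℝ × ℝ × ℝ) → ℝ) (τ : ℝ) (ξ : ℝ × ℝ × ℝ) : ℝ :=
  ⨆ α : StrategyI τ T RY RZ, ⨅ z : Control τ T RZ,
    ((∫ t in τ..T,
        F t (horiz τ ξ (fun s => -(z.1 s)) t) ((α.toFun z).1 t) (z.1 t)) +
      g (horiz τ ξ (fun s => -(z.1 s)) T))

/-- The horizontal derivative `X₁u(x) = ∂_{x₁}u - (x₂/2)∂_{x₃}u`, as a line derivative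
along the horizontal direction `(1, 0, -x₂/2)`. -/
def X1d (u : ℝ × ℝ × ℝ → ℝ) (x : ℝ × ℝ × ℝ) : ℝ :=
  deriv (fun s : ℝ => u (x.1 + s, x.2.1, x.2.2 - s * x.2.1 / 2)) 0

/-- The horizontal derivative `X₂u(x) = ∂_{x₂}u + (x₁/2)∂_{x₃}u`. -/
def X2d (u : ℝ × ℝ × ℝ → ℝ) (x : ℝ × ℝ × ℝ) : ℝ :=
  deriv (fun s : ℝ => u (x.1, x.2.1 + s, x.2.2 + s * x.1 / 2)) 0

/-- The horizontal gradient `∇_H u(t,x) = (X₁u(t,·)(x), X₂u(t,·)(x)) ∈ ℝ²` of a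
function of `(t,x)`. -/
def gradH (u : ℝ → (ℝ × ℝ × ℝ) → ℝ) (t : ℝ) (x : ℝ × ℝ × ℝ) : ℝ × ℝ :=
  (X1d (u t) x, X2d (u t) x)

/-- The time derivative `∂u/∂t (t,x)`. -/
def partialT (u : ℝ → (ℝ × ℝ × ℝ) → ℝ) (t : ℝ) (x : ℝ × ℝ × ℝ) : ℝ :=
  deriv (fun s : ℝ => u s x) t

/-- `u ∈ Γ¹((0,T)×ℍ)`: the derivatives `∂u/∂t`, `X₁u`, `X₂u` exist and
`(t,x) ↦ (∂u/∂t, X₁u, X₂u)(t,x)` is continuous on `(0,T)×ℍ`. -/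
def Gamma1On (T : ℝ) (u : ℝ → (ℝ × ℝ × ℝ) → ℝ) : Prop :=
  (∀ t ∈ Set.Ioo 0 T, ∀ x : ℝ × ℝ × ℝ,
      DifferentiableAt ℝ (fun s : ℝ => u s x) t ∧
      DifferentiableAt ℝ (fun s : ℝ => u t (x.1 + s, x.2.1, x.2.2 - s * x.2.1 / 2)) 0 ∧
      DifferentiableAt ℝ (fun s : ℝ => u t (x.1, x.2.1 + s, x.2.2 + s * x.1 / 2)) 0) ∧
  ContinuousOn (fun p : ℝ × (ℝ × ℝ × ℝ) => (partialT u p.1 p.2, gradH u p.1 p.2))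
    (Set.Ioo 0 T ×ˢ (Set.univ : Set (ℝ × ℝ × ℝ)))

/-- The lower Hamiltonian `H⁻(t,x,λ) = max_{y∈Y} min_{z∈Z} (F(t,x,y,z) - λ·z)`. -/
def lowerHam (RY RZ : ℝ) (F : ℝ → (ℝ × ℝ × ℝ) → (ℝ × ℝ) → (ℝ × ℝ) → ℝ)
    (t : ℝ) (x : ℝ × ℝ × ℝ) (lam : ℝ × ℝ) : ℝ :=
  ⨆ y : {y : ℝ × ℝ // norm2 y ≤ RY}, ⨅ z : {z : ℝ × ℝ // norm2 z ≤ RZ},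
    (F t x y.1 z.1 - dot2 lam z.1)

/-- The upper Hamiltonian `H⁺(t,x,λ) = min_{z∈Z} max_{y∈Y} (F(t,x,y,z) - λ·z)`. -/
def upperHam (RY RZ : ℝ) (F : ℝ → (ℝ × ℝ × ℝ) → (ℝ × ℝ) → (ℝ × ℝ) → ℝ)
    (t : ℝ) (x : ℝ × ℝ × ℝ) (lam : ℝ × ℝ) : ℝ :=
  ⨅ z : {z : ℝ × ℝ // norm2 z ≤ RZ}, ⨆ y : {y : ℝ × ℝ // norm2 y ≤ RY},
    (F t x y.1 z.1 - dot2 lam z.1)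

/-- `u` is a viscosity solution of `∂u/∂t + 𝓗(t,x,∇_H u) = 0` on `(0,T)×ℍ` with
terminal condition `u(T,x) = g(x)`: `u` is bounded and uniformly continuous,
`u(T,·) = g`, and the sub/supersolution inequalities hold for `Γ¹` test functions
touching `u` from above/below. -/
def IsViscositySolutionTerminal (T : ℝ) (H : ℝ → (ℝ × ℝ × ℝ) → (ℝ × ℝ) → ℝ)
    (g : (ℝ × ℝ × ℝ) → ℝ) (u : ℝ → (ℝ × ℝ × ℝ) → ℝ) : Prop :=
  (∃ M : ℝ, ∀ t ∈ Set.Icc 0 T, ∀ x : ℝ × ℝ × ℝ, |u t x| ≤ M) ∧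
  UniformContinuousOn (fun p : ℝ × (ℝ × ℝ × ℝ) => u p.1 p.2)
    (Set.Icc 0 T ×ˢ (Set.univ : Set (ℝ × ℝ × ℝ))) ∧
  (∀ x : ℝ × ℝ × ℝ, u T x = g x) ∧
  (∀ t0 ∈ Set.Ioo 0 T, ∀ x0 : ℝ × ℝ × ℝ, ∀ ψ : ℝ → (ℝ × ℝ × ℝ) → ℝ,
    Gamma1On T ψ → u t0 x0 = ψ t0 x0 →
    (∀ᶠ p : ℝ × (ℝ × ℝ × ℝ) in nhds (t0, x0), u p.1 p.2 ≤ ψ p.1 p.2) →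
    0 ≤ partialT ψ t0 x0 + H t0 x0 (gradH ψ t0 x0)) ∧
  (∀ t0 ∈ Set.Ioo 0 T, ∀ x0 : ℝ × ℝ × ℝ, ∀ ψ : ℝ → (ℝ × ℝ × ℝ) → ℝ,
    Gamma1On T ψ → u t0 x0 = ψ t0 x0 →
    (∀ᶠ p : ℝ × (ℝ × ℝ × ℝ) in nhds (t0, x0), ψ p.1 p.2 ≤ u p.1 p.2) →
    partialT ψ t0 x0 + H t0 x0 (gradH ψ t0 x0) ≤ 0)

/-- `u` is a viscosity solution of `∂u/∂t + 𝓗(t,x,∇_H u) = 0` on `(0,T)×ℍ` with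
initial condition `u(0,x) = g(x)` (the inequalities are reversed w.r.t. the terminal
value problem). -/
def IsViscositySolutionInitial (T : ℝ) (H : ℝ → (ℝ × ℝ × ℝ) → (ℝ × ℝ) → ℝ)
    (g : (ℝ × ℝ × ℝ) → ℝ) (u : ℝ → (ℝ × ℝ × ℝ) → ℝ) : Prop :=
  (∃ M : ℝ, ∀ t ∈ Set.Icc 0 T, ∀ x : ℝ × ℝ × ℝ, |u t x| ≤ M) ∧
  UniformContinuousOn (fun p : ℝ × (ℝ × ℝ × ℝ) => u p.1 p.2)
    (Set.Icc 0 T ×ˢ (Set.univ : Set (ℝ × ℝ × ℝ))) ∧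
  (∀ x : ℝ × ℝ × ℝ, u 0 x = g x) ∧
  (∀ t0 ∈ Set.Ioo 0 T, ∀ x0 : ℝ × ℝ × ℝ, ∀ ψ : ℝ → (ℝ × ℝ × ℝ) → ℝ,
    Gamma1On T ψ → u t0 x0 = ψ t0 x0 →
    (∀ᶠ p : ℝ × (ℝ × ℝ × ℝ) in nhds (t0, x0), u p.1 p.2 ≤ ψ p.1 p.2) →
    partialT ψ t0 x0 + H t0 x0 (gradH ψ t0 x0) ≤ 0) ∧
  (∀ t0 ∈ Set.Ioo 0 T, ∀ x0 : ℝ × ℝ × ℝ, ∀ ψ : ℝ → (ℝ × ℝ × ℝ) → ℝ,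
    Gamma1On T ψ → u t0 x0 = ψ t0 x0 →
    (∀ᶠ p : ℝ × (ℝ × ℝ × ℝ) in nhds (t0, x0), ψ p.1 p.2 ≤ u p.1 p.2) →
    0 ≤ partialT ψ t0 x0 + H t0 x0 (gradH ψ t0 x0))

lemma abs_fst_le_norm2 (v : ℝ × ℝ) : |v.1| ≤ norm2 v :=
  Real.abs_le_sqrt (by nlinarith [sq_nonneg v.2])

lemma abs_snd_le_norm2 (v : ℝ × ℝ) : |v.2| ≤ norm2 v :=
  Real.abs_le_sqrt (by nlinarith [sq_nonneg v.1])

lemma abs_dot2_le (v w : ℝ × ℝ) : |dot2 v w| ≤ norm2 v * (|w.1| + |w.2|) := by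
  unfold dot2
  calc |v.1 * w.1 + v.2 * w.2| ≤ |v.1| * |w.1| + |v.2| * |w.2| := by
        simpa only [abs_mul] using abs_add_le (v.1 * w.1) (v.2 * w.2)
    _ ≤ norm2 v * |w.1| + norm2 v * |w.2| := by
        gcongr
        · exact abs_fst_le_norm2 v
        · exact abs_snd_le_norm2 v
    _ = _ := by ring

lemma dot2_comm (v w : ℝ × ℝ) : dot2 v w = dot2 w v := by
  unfold dot2; ring

lemma continuous_norm2 : Continuous norm2 := by
  unfold norm2; fun_prop

lemma norm2_zero : norm2 0 = 0 := by simp [norm2]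

/-- A strict pointwise bound on a continuous function can be achieved by a measurable choice of
the second variable. -/
lemma exists_measurable_selector {α β : Type*} [TopologicalSpace α] [MeasurableSpace α]
    [OpensMeasurableSpace α] [TopologicalSpace β] [SecondCountableTopology β] [MeasurableSpace β]
    {Y : Set α} (hY : IsClosed Y) {Z : Set β} (hZ : Z.Nonempty) {G : α → β → ℝ}
    (hG : ContinuousOn (fun p : α × β => G p.1 p.2) (Y ×ˢ Z)) {c : ℝ}
    (h : ∀ y ∈ Y, ∃ z ∈ Z, G y z < c) :
    ∃ φ : α → β, Measurable φ ∧ (∀ y, φ y ∈ Z) ∧ ∀ y ∈ Y, G y (φ y) < c := by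
  classical
  have : Nonempty Z := hZ.to_subtype
  let u : ℕ → Z := TopologicalSpace.denseSeq Z
  have hex : ∀ y, ∃ n, y ∈ Y → G y (u n) < c := by
    intro y
    by_cases hy : y ∈ Y
    · obtain ⟨z, hz, hlt⟩ := h y hy
      have hc : Continuous fun w : Z => G y w :=
        hG.comp_continuous (f := fun w : Z => (y, (w : β))) (by fun_prop) fun w => ⟨hy, w.2⟩
      obtain ⟨n, hn⟩ := (TopologicalSpace.denseRange_denseSeq Z).exists_mem_open
        (isOpen_Iio.preimage hc : IsOpen ((fun w : Z => G y w) ⁻¹' Iio c)) ⟨⟨z, hz⟩, hlt⟩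
      exact ⟨n, fun _ => hn⟩
    · exact ⟨0, fun hy' => absurd hy' hy⟩
  have hmeas : ∀ n, MeasurableSet {y | y ∈ Y → G y (u n) < c} := by
    intro n
    have hc : ContinuousOn (fun y => G y (u n)) Y :=
      hG.comp (f := fun y => (y, (u n : β))) (by fun_prop) fun y hy => ⟨hy, (u n).2⟩
    have hcl : IsClosed (Y ∩ (fun y => G y (u n)) ⁻¹' Ici c) :=
      hc.preimage_isClosed_of_isClosed hY isClosed_Ici
    convert hcl.measurableSet.compl using 1
    ext y
    simp
  refine ⟨fun y => u (Nat.find (hex y)), ?_, fun y => (u _).2, fun y hy => Nat.find_spec (hex y) hy⟩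
  exact (measurable_from_nat (f := fun n => (u n : β))).comp (measurable_find hex hmeas)

/-- If the lower Hamiltonian is below `c`, every `y` has an answer `z` achieving a value below
`c`. -/
lemma exists_lt_of_lowerHam_lt {RY RZ C : ℝ} (hRZ : 0 ≤ RZ)
    {F : ℝ → (ℝ × ℝ × ℝ) → (ℝ × ℝ) → (ℝ × ℝ) → ℝ} {t : ℝ} {x : ℝ × ℝ × ℝ} {lam : ℝ × ℝ}
    (hF : ∀ y z : ℝ × ℝ, norm2 y ≤ RY → norm2 z ≤ RZ → |F t x y z| ≤ C) {c : ℝ}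
    (h : lowerHam RY RZ F t x lam < c) {y : ℝ × ℝ} (hy : norm2 y ≤ RY) :
    ∃ z, norm2 z ≤ RZ ∧ F t x y z - dot2 lam z < c := by
  have : Nonempty {z : ℝ × ℝ // norm2 z ≤ RZ} := ⟨⟨0, by rw [norm2_zero]; exact hRZ⟩⟩
  have hbelow : ∀ y : {y : ℝ × ℝ // norm2 y ≤ RY}, BddBelow (Set.range
      fun z : {z : ℝ × ℝ // norm2 z ≤ RZ} => F t x y.1 z.1 - dot2 lam z.1) := by
    intro y
    refine ⟨-C - RZ * (|lam.1| + |lam.2|), ?_⟩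
    rintro _ ⟨z, rfl⟩
    have h1 := (abs_le.1 (hF y.1 z.1 y.2 z.2)).1
    have h2 := (le_abs_self _).trans (abs_dot2_le z.1 lam)
    have h3 : norm2 z.1 * (|lam.1| + |lam.2|) ≤ RZ * (|lam.1| + |lam.2|) := by
      gcongr; exact z.2
    rw [dot2_comm] at h2
    dsimp only
    linarith
  have habove : BddAbove (Set.range fun y : {y : ℝ × ℝ // norm2 y ≤ RY} =>
      ⨅ z : {z : ℝ × ℝ // norm2 z ≤ RZ}, (F t x y.1 z.1 - dot2 lam z.1)) := by
    refine ⟨C, ?_⟩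
    rintro _ ⟨y, rfl⟩
    have h0 : norm2 0 ≤ RZ := by rw [norm2_zero]; exact hRZ
    refine (ciInf_le (hbelow y) ⟨0, h0⟩).trans ?_
    have := (abs_le.1 (hF y.1 0 y.2 h0)).2
    simpa [dot2] using this
  obtain ⟨z, hz⟩ := exists_lt_of_ciInf_lt ((le_ciSup habove ⟨y, hy⟩).trans_lt h)
  exact ⟨z.1, z.2, hz⟩

section Horizontal

variable {z : ℝ → ℝ × ℝ} {R : ℝ}

lemma intervalIntegrable_fst_of_norm2_le (hz : Measurable z) (hb : ∀ s, norm2 (z s) ≤ R)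
    (a b : ℝ) : IntervalIntegrable (fun s => (z s).1) volume a b :=
  (intervalIntegrable_const (c := R)).mono_fun hz.fst.aestronglyMeasurable
    (Filter.Eventually.of_forall fun s => by
      simpa using ((abs_fst_le_norm2 _).trans (hb s)).trans (le_abs_self R))

lemma intervalIntegrable_snd_of_norm2_le (hz : Measurable z) (hb : ∀ s, norm2 (z s) ≤ R)
    (a b : ℝ) : IntervalIntegrable (fun s => (z s).2) volume a b :=
  (intervalIntegrable_const (c := R)).mono_fun hz.snd.aestronglyMeasurable
    (Filter.Eventually.of_forall fun s => by
      simpa using ((abs_snd_le_norm2 _).trans (hb s)).trans (le_abs_self R))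

lemma continuous_horiz (hz : Measurable z) (hb : ∀ s, norm2 (z s) ≤ R) (a : ℝ)
    (ξ : ℝ × ℝ × ℝ) : Continuous (horiz a ξ z) := by
  have i1 := intervalIntegrable_fst_of_norm2_le hz hb
  have i2 := intervalIntegrable_snd_of_norm2_le hz hb
  have c1 : Continuous fun t => ξ.1 + ∫ s in a..t, (z s).1 :=
    continuous_const.add (intervalIntegral.continuous_primitive i1 a)
  have c2 : Continuous fun t => ξ.2.1 + ∫ s in a..t, (z s).2 :=
    continuous_const.add (intervalIntegral.continuous_primitive i2 a)
  refine c1.prodMk (c2.prodMk (continuous_const.add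
    (intervalIntegral.continuous_primitive (fun b c => ?_) a)))
  exact (((i2 b c).mul_continuousOn c1.continuousOn).sub
    ((i1 b c).mul_continuousOn c2.continuousOn)).div_const 2

/-- A horizontal curve of bounded velocity stays close to its initial point, with a rate that
depends only on the bound. -/
lemma dist_horiz_le (hb : ∀ s, norm2 (z s) ≤ R) {a t : ℝ} (hat : a ≤ t) (hta : t ≤ a + 1)
    (ξ : ℝ × ℝ × ℝ) :
    dist (horiz a ξ z t) ξ ≤ (R + R * (|ξ.1| + |ξ.2.1| + 2 * R)) * (t - a) := by
  have hR : 0 ≤ R := (Real.sqrt_nonneg _).trans (hb 0)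
  have b1 : ∀ s, a ≤ s → |∫ r in a..s, (z r).1| ≤ R * (s - a) := fun s hs => by
    simpa [abs_of_nonneg (sub_nonneg.2 hs)] using
      intervalIntegral.norm_integral_le_of_norm_le_const (a := a) (b := s) (C := R)
        (f := fun r => (z r).1) fun r _ => (abs_fst_le_norm2 _).trans (hb r)
  have b2 : ∀ s, a ≤ s → |∫ r in a..s, (z r).2| ≤ R * (s - a) := fun s hs => by
    simpa [abs_of_nonneg (sub_nonneg.2 hs)] using
      intervalIntegral.norm_integral_le_of_norm_le_const (a := a) (b := s) (C := R)
        (f := fun r => (z r).2) fun r _ => (abs_snd_le_norm2 _).trans (hb r)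
  have b3 : |∫ s in a..t, ((z s).2 * (ξ.1 + ∫ r in a..s, (z r).1) -
      (z s).1 * (ξ.2.1 + ∫ r in a..s, (z r).2)) / 2| ≤
      R * (|ξ.1| + |ξ.2.1| + 2 * R) * (t - a) := by
    have key : ∀ s ∈ Set.uIoc a t, ‖((z s).2 * (ξ.1 + ∫ r in a..s, (z r).1) -
        (z s).1 * (ξ.2.1 + ∫ r in a..s, (z r).2)) / 2‖ ≤ R * (|ξ.1| + |ξ.2.1| + 2 * R) := by
      intro s hs
      rw [Set.uIoc_of_le hat] at hs
      have hle : R * (s - a) ≤ R := by nlinarith [hs.1, hs.2]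
      have e1 : |ξ.1 + ∫ r in a..s, (z r).1| ≤ |ξ.1| + R :=
        (abs_add_le _ _).trans (by linarith [b1 s hs.1.le])
      have e2 : |ξ.2.1 + ∫ r in a..s, (z r).2| ≤ |ξ.2.1| + R :=
        (abs_add_le _ _).trans (by linarith [b2 s hs.1.le])
      have m1 := mul_le_mul ((abs_snd_le_norm2 (z s)).trans (hb s)) e1 (abs_nonneg _) hR
      have m2 := mul_le_mul ((abs_fst_le_norm2 (z s)).trans (hb s)) e2 (abs_nonneg _) hR
      rw [← abs_mul] at m1 m2
      have m3 := abs_sub ((z s).2 * (ξ.1 + ∫ r in a..s, (z r).1))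
        ((z s).1 * (ξ.2.1 + ∫ r in a..s, (z r).2))
      have m4 : 0 ≤ |(z s).2 * (ξ.1 + ∫ r in a..s, (z r).1) -
        (z s).1 * (ξ.2.1 + ∫ r in a..s, (z r).2)| := abs_nonneg _
      rw [Real.norm_eq_abs, abs_div, abs_two]
      linarith
    simpa only [Real.norm_eq_abs, abs_of_nonneg (sub_nonneg.2 hat)] using
      intervalIntegral.norm_integral_le_of_norm_le_const key
  have hM : 0 ≤ R * (|ξ.1| + |ξ.2.1| + 2 * R) := by positivity
  have hta' : 0 ≤ t - a := sub_nonneg.2 hat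
  have p1 := mul_nonneg hR hta'
  have p2 := mul_nonneg hM hta'
  rw [Prod.dist_eq, Prod.dist_eq]
  simp only [horiz, Real.dist_eq, add_sub_cancel_left]
  refine max_le ?_ (max_le ?_ ?_)
  · linarith [b1 t hat]
  · linarith [b2 t hat]
  · linarith

end Horizontal

/-- A function that is continuous and bounded on a closed set is integrable along a measurable
path in that set. -/
lemma intervalIntegrable_comp_of_continuousOn {α : Type*} [TopologicalSpace α]
    [MeasurableSpace α] [BorelSpace α] {K : Set α} (hK : IsClosed K) {f : α → ℝ}
    (hf : ContinuousOn f K) {C : ℝ} (hC : ∀ p ∈ K, |f p| ≤ C) {γ : ℝ → α} (hγ : Measurable γ)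
    {a b : ℝ} (hab : a ≤ b) (hmem : ∀ s ∈ Set.Icc a b, γ s ∈ K) :
    IntervalIntegrable (fun s => f (γ s)) volume a b := by
  classical
  have hm : Measurable (K.piecewise f 0) :=
    hf.measurable_piecewise continuousOn_const hK.measurableSet
  have hae : (fun s => f (γ s)) =ᵐ[volume.restrict (Set.uIoc a b)]
      fun s => K.piecewise f 0 (γ s) := by
    rw [Set.uIoc_of_le hab]
    filter_upwards [ae_restrict_mem measurableSet_Ioc] with s hs
    exact (Set.piecewise_eq_of_mem _ _ _ (hmem s ⟨hs.1.le, hs.2⟩)).symm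
  refine (intervalIntegrable_const (c := C)).mono_fun
    ((hm.comp hγ).aestronglyMeasurable.congr hae.symm) ?_
  rw [Set.uIoc_of_le hab]
  filter_upwards [ae_restrict_mem measurableSet_Ioc] with s hs
  simpa using (hC _ (hmem s ⟨hs.1.le, hs.2⟩)).trans (le_abs_self C)

/-- The nonanticipative strategy that answers `y` by a measurable function of its current
value. -/
def Strategy.ofFeedback (τ T RY RZ : ℝ) (φ : ℝ × ℝ → ℝ × ℝ) (hφ : Measurable φ)
    (hb : ∀ y, norm2 (φ y) ≤ RZ) : Strategy τ T RY RZ where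
  toFun y := ⟨fun s => φ (y.1 s), hφ.comp y.2.1, fun _ _ => hb _⟩
  nonanticipative t _ y y' h := by
    filter_upwards [h] with s hs
    exact congrArg φ hs

/-- if `∂ψ/∂t(t₀,x₀) + H⁻(t₀,x₀,∇_Hψ(t₀,x₀)) ≤ -θ < 0`, then for all
sufficiently small `τ > 0` there is a nonanticipative strategy `β̃ ∈ 𝒮_β(t₀)` such that
for every control `ỹ ∈ 𝒴(t₀)` the integral inequality `... ≤ -τθ/2` holds along the
horizontal curve with velocity `β̃[ỹ]` starting at `x₀`. -/
theorem stmt_12 (T RY RZ C1 C1' : ℝ) (hT : 0 < T) (hRY : 0 < RY) (hRZ : 0 < RZ)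
    (F : ℝ → (ℝ × ℝ × ℝ) → (ℝ × ℝ) → (ℝ × ℝ) → ℝ)
    (hFuc : UniformContinuousOn
      (fun p : ℝ × (ℝ × ℝ × ℝ) × (ℝ × ℝ) × (ℝ × ℝ) => F p.1 p.2.1 p.2.2.1 p.2.2.2)
      (Set.Icc 0 T ×ˢ (Set.univ : Set (ℝ × ℝ × ℝ)) ×ˢ
        {y : ℝ × ℝ | norm2 y ≤ RY} ×ˢ {z : ℝ × ℝ | norm2 z ≤ RZ}))
    (hFb : ∀ t ∈ Set.Icc 0 T, ∀ (x : ℝ × ℝ × ℝ) (y z : ℝ × ℝ),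
      norm2 y ≤ RY → norm2 z ≤ RZ → |F t x y z| ≤ C1)
    (hFl : ∀ t ∈ Set.Icc 0 T, ∀ (x x' : ℝ × ℝ × ℝ) (y z : ℝ × ℝ),
      norm2 y ≤ RY → norm2 z ≤ RZ → |F t x y z - F t x' y z| ≤ C1' * dG x x')
    (ψ : ℝ → (ℝ × ℝ × ℝ) → ℝ) (hψ : Gamma1On T ψ)
    (t0 : ℝ) (ht0 : t0 ∈ Set.Ioo 0 T) (x0 : ℝ × ℝ × ℝ)
    (θ : ℝ) (hθ : 0 < θ)
    (hineq : partialT ψ t0 x0 + lowerHam RY RZ F t0 x0 (gradH ψ t0 x0) ≤ -θ) :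
    ∃ τ0 > 0, ∀ τ : ℝ, 0 < τ → τ ≤ τ0 →
      ∃ βtil : Strategy t0 T RY RZ, ∀ ytil : Control t0 T RY,
        (∫ s in t0..(t0 + τ),
            (partialT ψ s (horiz t0 x0 ((βtil.toFun ytil).1) s) +
              F s (horiz t0 x0 ((βtil.toFun ytil).1) s) (ytil.1 s)
                ((βtil.toFun ytil).1 s) -
              dot2 ((βtil.toFun ytil).1 s)
                (gradH ψ s (horiz t0 x0 ((βtil.toFun ytil).1) s)))) ≤
          -(τ * θ / 2) := by
  obtain ⟨ht0pos, ht0T⟩ := ht0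
  have hYcl : IsClosed {y : ℝ × ℝ | norm2 y ≤ RY} := isClosed_le continuous_norm2 continuous_const
  have hZcl : IsClosed {z : ℝ × ℝ | norm2 z ≤ RZ} := isClosed_le continuous_norm2 continuous_const
  set K : Set (ℝ × (ℝ × ℝ × ℝ) × (ℝ × ℝ) × (ℝ × ℝ)) :=
    Set.Icc 0 T ×ˢ (Set.univ : Set (ℝ × ℝ × ℝ)) ×ˢ
        {y : ℝ × ℝ | norm2 y ≤ RY} ×ˢ {z : ℝ × ℝ | norm2 z ≤ RZ} with hK
  have hKcl : IsClosed K :=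
    isClosed_Icc.prod (isClosed_univ.prod (hYcl.prod hZcl))
  have ht0mem : t0 ∈ Set.Icc 0 T := ⟨ht0pos.le, ht0T.le⟩
  -- a feedback law that is nearly optimal at `(t0, x0)`
  obtain ⟨φ, hφm, hφZ, hφ⟩ : ∃ φ : ℝ × ℝ → ℝ × ℝ, Measurable φ ∧ (∀ y, norm2 (φ y) ≤ RZ) ∧
      ∀ y, norm2 y ≤ RY →
        F t0 x0 y (φ y) - dot2 (gradH ψ t0 x0) (φ y) < -(7 * θ / 8) - partialT ψ t0 x0 := by
    refine exists_measurable_selector (Z := {z : ℝ × ℝ | norm2 z ≤ RZ})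
      (G := fun y z => F t0 x0 y z - dot2 (gradH ψ t0 x0) z) hYcl
      ⟨0, by simp [norm2_zero, hRZ.le]⟩ ?_
      fun y hy => exists_lt_of_lowerHam_lt hRZ.le (hFb t0 ht0mem x0) (by linarith) hy
    refine ContinuousOn.sub ?_ (by unfold dot2; fun_prop)
    exact hFuc.continuousOn.comp (f := fun p : (ℝ × ℝ) × (ℝ × ℝ) => (t0, x0, p.1, p.2))
      (by fun_prop) fun p hp => ⟨ht0mem, Set.mem_univ _, hp.1, hp.2⟩
  -- moduli of continuity
  obtain ⟨δ₁, hδ₁, hF⟩ := Metric.uniformContinuousOn_iff.1 hFuc (θ / 8) (by positivity)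
  have hη : 0 < min (θ / 8) (θ / (16 * RZ)) := by positivity
  have hat : ContinuousAt (fun p : ℝ × (ℝ × ℝ × ℝ) => (partialT ψ p.1 p.2, gradH ψ p.1 p.2))
      (t0, x0) :=
    hψ.2.continuousAt ((isOpen_Ioo.prod isOpen_univ).mem_nhds ⟨⟨ht0pos, ht0T⟩, Set.mem_univ _⟩)
  obtain ⟨δ₂, hδ₂, hD⟩ := Metric.continuousAt_iff.1 hat _ hη
  set L : ℝ := 1 + (RZ + RZ * (|x0.1| + |x0.2.1| + 2 * RZ)) with hL
  have hL1 : 1 ≤ L := by rw [hL, le_add_iff_nonneg_right]; positivity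
  have hLpos : 0 < L := by linarith
  refine ⟨min (min 1 ((T - t0) / 2)) (min (δ₁ / (2 * L)) (δ₂ / (2 * L))),
    lt_min (lt_min one_pos (by linarith)) (lt_min (by positivity) (by positivity)), ?_⟩
  intro τ hτ hτle
  simp only [le_min_iff, le_div_iff₀ (show 0 < 2 * L by positivity)] at hτle
  obtain ⟨⟨hτ1, hτT⟩, hτδ₁, hτδ₂⟩ := hτle
  refine ⟨Strategy.ofFeedback t0 T RY RZ φ hφm hφZ, fun y => ?_⟩
  set z : ℝ → ℝ × ℝ := fun s => φ (y.1 s) with hz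
  change (∫ s in t0..(t0 + τ), (partialT ψ s (horiz t0 x0 z s) +
    F s (horiz t0 x0 z s) (y.1 s) (z s) - dot2 (z s) (gradH ψ s (horiz t0 x0 z s)))) ≤ _
  have hzm : Measurable z := hφm.comp y.2.1
  have hzb : ∀ s, norm2 (z s) ≤ RZ := fun s => hφZ _
  have hxc : Continuous (horiz t0 x0 z) := continuous_horiz hzm hzb t0 x0
  have hle : t0 ≤ t0 + τ := by linarith
  have hsT : ∀ s ∈ Set.Icc t0 (t0 + τ), s ∈ Set.Ioo 0 T :=
    fun s hs => ⟨by linarith [hs.1], by linarith [hs.2]⟩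
  have hyb : ∀ s ∈ Set.Icc t0 (t0 + τ), norm2 (y.1 s) ≤ RY :=
    fun s hs => y.2.2 s ⟨hs.1, (hsT s hs).2.le⟩
  have hDc : ContinuousOn (fun s => (partialT ψ s (horiz t0 x0 z s),
      gradH ψ s (horiz t0 x0 z s))) (Set.uIcc t0 (t0 + τ)) := by
    rw [Set.uIcc_of_le hle]
    exact hψ.2.comp (f := fun s => (s, horiz t0 x0 z s)) (by fun_prop)
      fun s hs => ⟨hsT s hs, Set.mem_univ _⟩
  have hint : IntervalIntegrable (fun s => partialT ψ s (horiz t0 x0 z s) +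
      F s (horiz t0 x0 z s) (y.1 s) (z s) - dot2 (z s) (gradH ψ s (horiz t0 x0 z s)))
      volume t0 (t0 + τ) := by
    refine (hDc.fst.intervalIntegrable.add ?_).sub ?_
    · exact intervalIntegrable_comp_of_continuousOn hKcl hFuc.continuousOn (C := C1)
        (fun p hp => hFb p.1 hp.1 p.2.1 _ _ hp.2.2.1 hp.2.2.2)
        (γ := fun s => (s, horiz t0 x0 z s, y.1 s, z s))
        (measurable_id.prodMk (hxc.measurable.prodMk (y.2.1.prodMk hzm))) hle
        fun s hs => ⟨Set.Ioo_subset_Icc_self (hsT s hs), Set.mem_univ _, hyb s hs, hzb s⟩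
    · exact ((intervalIntegrable_fst_of_norm2_le hzm hzb _ _).mul_continuousOn hDc.snd.fst).add
        ((intervalIntegrable_snd_of_norm2_le hzm hzb _ _).mul_continuousOn hDc.snd.snd)
  have hpt : ∀ s ∈ Set.Icc t0 (t0 + τ), partialT ψ s (horiz t0 x0 z s) +
      F s (horiz t0 x0 z s) (y.1 s) (z s) - dot2 (z s) (gradH ψ s (horiz t0 x0 z s)) ≤
      -(θ / 2) := by
    intro s hs
    have hst : s - t0 ≤ τ := by linarith [hs.2]
    have hst0 : 0 ≤ s - t0 := by linarith [hs.1]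
    have hdx : dist (horiz t0 x0 z s) x0 ≤ L * τ := by
      refine (dist_horiz_le hzb hs.1 (by linarith) x0).trans ?_
      rw [hL] at hLpos ⊢
      have : 0 ≤ RZ + RZ * (|x0.1| + |x0.2.1| + 2 * RZ) := by positivity
      nlinarith
    have hds : dist s t0 ≤ L * τ := by
      rw [Real.dist_eq, abs_of_nonneg hst0]; nlinarith
    have hlt : 0 < L * τ := by positivity
    have h1 := hF (s, horiz t0 x0 z s, y.1 s, z s)
      ⟨Set.Ioo_subset_Icc_self (hsT s hs), Set.mem_univ _, hyb s hs, hzb s⟩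
      (t0, x0, y.1 s, z s) ⟨ht0mem, Set.mem_univ _, hyb s hs, hzb s⟩ (by
        change max (dist s t0) (max (dist (horiz t0 x0 z s) x0)
          (max (dist (y.1 s) (y.1 s)) (dist (z s) (z s)))) < δ₁
        rw [dist_self, dist_self, max_self]
        exact max_lt (by linarith) (max_lt (by linarith) hδ₁))
    have h2 := @hD (s, horiz t0 x0 z s) (by
      rw [Prod.dist_eq]
      exact max_lt (by dsimp only; linarith) (by dsimp only; linarith))
    simp only [Prod.dist_eq, Real.dist_eq, max_lt_iff, lt_min_iff] at h1 h2
    obtain ⟨⟨hp, -⟩, -, hg1, hg2⟩ := h2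
    have hdot := abs_dot2_le (z s) (gradH ψ t0 x0 - gradH ψ s (horiz t0 x0 z s))
    have hdot' : norm2 (z s) * (|(gradH ψ t0 x0 - gradH ψ s (horiz t0 x0 z s)).1| +
        |(gradH ψ t0 x0 - gradH ψ s (horiz t0 x0 z s)).2|) ≤
        RZ * (θ / (16 * RZ) + θ / (16 * RZ)) := by
      simp only [Prod.fst_sub, Prod.snd_sub]
      rw [abs_sub_comm] at hg1 hg2
      gcongr
      exact hzb s
    have hRZ' : RZ * (θ / (16 * RZ) + θ / (16 * RZ)) = θ / 8 := by field_simp; ring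
    have hsub : dot2 (z s) (gradH ψ t0 x0 - gradH ψ s (horiz t0 x0 z s)) =
        dot2 (gradH ψ t0 x0) (z s) - dot2 (z s) (gradH ψ s (horiz t0 x0 z s)) := by
      simp only [dot2, Prod.fst_sub, Prod.snd_sub]; ring
    have h3 := hφ (y.1 s) (hyb s hs)
    rw [hsub] at hdot
    have h4 := (le_abs_self _).trans hdot
    have h5 := (abs_lt.1 hp).2
    have h6 := (abs_lt.1 h1).2
    linarith
  calc _ ≤ ∫ _ in t0..(t0 + τ), -(θ / 2) :=
        intervalIntegral.integral_mono_on hle hint intervalIntegrable_const hpt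
    _ = -(τ * θ / 2) := by
        rw [intervalIntegral.integral_const, smul_eq_mul]; ring
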